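/- arXiv:2006.01891 — 3 statements merged into one kernel-verified Lean document; each statement's English description precedes it below -/
import Mathlib

section
/- Let F be a field of characteristic not equal to 2 and let F₁, …, Fₙ (n ≥ 2) be field extensions of F satisfying conditions (I) and (II). Suppose R(F₁) = F₁× and R(Fᵢ) = (Fᵢ×)² for i = 2, …, n. Then R(F) = F× ∩ (F₂×)² ∩ … ∩ (Fₙ×)². -/
/-- `DSet F x` is the value set `D_F⟨1,x⟩` of the binary quadratic form `X² + xY²`. -/
def DSet (F : Type*) [Field F] (x : F) : Set F :=
  {z : F | z ≠ 0 ∧ ∃ u v : F, z = u ^ 2 + x * v ^ 2}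

/-- The Kaplansky radical `R(F)`. -/
def KRad (F : Type*) [Field F] : Set F :=
  {a : F | a ≠ 0 ∧ ∀ b : F, b ≠ 0 → ∃ u v : F, b = u ^ 2 - a * v ^ 2}

/-- Over a field with `2 ≠ 0`, the form `X² - w²Y²` is universal for `w ≠ 0`. -/
theorem exists_eq_sq_sub_sq_mul_sq {L : Type*} [Field L] (h2 : (2 : L) ≠ 0) {w : L}
    (hw : w ≠ 0) (y : L) : ∃ u v : L, y = u ^ 2 - w ^ 2 * v ^ 2 :=
  ⟨(y + 1) / 2, (y - 1) / (2 * w), by field_simp; ring⟩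

/-- If every element of `L×` is an element of `F×` up to squares, then a field homomorphism
`F → L` maps the Kaplansky radical of `F` into that of `L`. -/
theorem map_mem_KRad {F L : Type*} [Field F] [Field L] (g : F →+* L)
    (hg : ∀ y : L, y ≠ 0 → ∃ (c : F) (w : L), c ≠ 0 ∧ y = g c * w ^ 2)
    {a : F} (ha : a ∈ KRad F) : g a ∈ KRad L := by
  refine ⟨(map_ne_zero g).2 ha.1, fun y hy => ?_⟩
  obtain ⟨c, w, hc, rfl⟩ := hg y hy
  obtain ⟨u, v, rfl⟩ := ha.2 c hc
  exact ⟨g u * w, g v * w, by simp only [map_sub, map_mul, map_pow]; ring⟩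

/-- Let `F` be a field of characteristic `≠ 2` and `F₁, …, Fₙ` (n ≥ 2)
field extensions of `F` satisfying conditions (I) and (II) (here `F₁ = K₁` is the
distinguished first factor and `K i`, `i : Fin m` with `m = n - 1 ≥ 1`, are the others).
Suppose `R(F₁) = F₁×` and `R(Fᵢ) = (Fᵢ×)²` for `i = 2, …, n`.  Then
`R(F) = F× ∩ (F₂×)² ∩ … ∩ (Fₙ×)²`. -/
theorem radical_of_free_factor_formula
    {F : Type*} [Field F] (hchar : ringChar F ≠ 2)
    (K₁ : Type*) [Field K₁] (f₁ : F →+* K₁)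
    {m : ℕ} (hm : 1 ≤ m) (K : Fin m → Type*) [∀ i, Field (K i)] (f : ∀ i, F →+* K i)
    -- condition (I): F× ∩ (F₁×)² ∩ ⋂ᵢ (Fᵢ×)² = F×² and F₁× = F×·(F₁×)², Fᵢ× = F×·(Fᵢ×)²
    (hIa : ∀ z : F, z ≠ 0 →
      (((∃ w : K₁, f₁ z = w ^ 2) ∧ ∀ i, ∃ w : K i, f i z = w ^ 2) ↔ ∃ c : F, z = c ^ 2))
    (hIb₁ : ∀ y : K₁, y ≠ 0 → ∃ (c : F) (w : K₁), c ≠ 0 ∧ y = f₁ c * w ^ 2)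
    (hIb : ∀ i, ∀ y : K i, y ≠ 0 → ∃ (c : F) (w : K i), c ≠ 0 ∧ y = f i c * w ^ 2)
    -- condition (II)
    (hII : ∀ x : F, x ≠ 0 → ∀ z : F, z ≠ 0 →
      (z ∈ DSet F x ↔ (f₁ z ∈ DSet K₁ (f₁ x) ∧ ∀ i, f i z ∈ DSet (K i) (f i x))))
    -- R(F₁) = F₁× and R(Fᵢ) = (Fᵢ×)² for the remaining factors
    (hfull : KRad K₁ = {y : K₁ | y ≠ 0})
    (htriv : ∀ i, KRad (K i) = {y : K i | y ≠ 0 ∧ ∃ w : K i, y = w ^ 2}) :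
    KRad F = {a : F | a ≠ 0 ∧ ∀ i, ∃ w : K i, f i a = w ^ 2} := by
  ext a
  constructor
  · intro ha
    refine ⟨ha.1, fun i => ?_⟩
    have h := map_mem_KRad (f i) (hIb i) ha
    rw [htriv i] at h
    exact h.2
  · rintro ⟨ha, hsq⟩
    refine ⟨ha, fun b hb => ?_⟩
    have hb_mem : b ∈ DSet F (-a) := by
      refine (hII (-a) (neg_ne_zero.2 ha) b hb).2
        ⟨⟨(map_ne_zero f₁).2 hb, ?_⟩, fun i => ⟨(map_ne_zero (f i)).2 hb, ?_⟩⟩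
      · have h : f₁ a ∈ KRad K₁ := by
          rw [hfull]
          exact (map_ne_zero f₁).2 ha
        obtain ⟨u, v, huv⟩ := h.2 (f₁ b) ((map_ne_zero f₁).2 hb)
        exact ⟨u, v, by rw [huv, map_neg]; ring⟩
      · obtain ⟨w, hw⟩ := hsq i
        have hw0 : w ≠ 0 := by
          rintro rfl
          exact (map_ne_zero (f i)).2 ha (by simpa using hw)
        have h2 : (2 : K i) ≠ 0 := by
          rw [← map_ofNat (f i) 2]
          exact (map_ne_zero (f i)).2 (Ring.two_ne_zero hchar)
        obtain ⟨u, v, huv⟩ := exists_eq_sq_sub_sq_mul_sq h2 hw0 (f i b)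
        exact ⟨u, v, by rw [huv, map_neg, hw]; ring⟩
    obtain ⟨-, u, v, huv⟩ := hb_mem
    exact ⟨u, v, by rw [huv]; ring⟩
end

section
/- Let F be a field of characteristic not equal to 2 and let F₁, …, Fₙ (n ≥ 2) be field extensions of F satisfying conditions (I) and (II). Suppose R(F₁) = F₁× and R(Fᵢ) = (Fᵢ×)² for i = 2, …, n. Then (F₁×)² ∩ R(F) = F×²; consequently the map induced by the inclusion F ↪ F₁ on square-class groups restricts to an injection R(F)/F×² → F₁×/(F₁×)². -/
/-- A field homomorphism `f : F →+* L` with `L× = f(F×) · (L×)²` maps `R(F)` into `R(L)`. -/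
theorem KRad.map_mem {F L : Type*} [Field F] [Field L] (f : F →+* L)
    (hf : ∀ y : L, y ≠ 0 → ∃ (c : F) (w : L), c ≠ 0 ∧ y = f c * w ^ 2)
    {a : F} (ha : a ∈ KRad F) : f a ∈ KRad L := by
  refine ⟨(map_ne_zero f).2 ha.1, fun y hy => ?_⟩
  obtain ⟨c, w, hc, rfl⟩ := hf y hy
  obtain ⟨u, v, rfl⟩ := ha.2 c hc
  refine ⟨f u * w, f v * w, ?_⟩
  simp only [map_sub, map_mul, map_pow]
  ring

/-- Let `F` be a field of characteristic `≠ 2` and `F₁, …, Fₙ` (n ≥ 2)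
field extensions of `F` satisfying conditions (I) and (II) (here `F₁ = K₁` is the
distinguished first factor and `K i`, `i : Fin m` with `m = n - 1 ≥ 1`, are the others).
Suppose `R(F₁) = F₁×` and `R(Fᵢ) = (Fᵢ×)²` for `i = 2, …, n`.  Then
`(F₁×)² ∩ R(F) = F×²`; consequently the map induced by the inclusion `F ↪ F₁` on
square-class groups restricts to an injection `R(F)/F×² → F₁×/(F₁×)²`. -/
theorem radical_embeds_in_free_factor_square_classes
    {F : Type*} [Field F] (hchar : ringChar F ≠ 2)
    (K₁ : Type*) [Field K₁] (f₁ : F →+* K₁)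
    {m : ℕ} (hm : 1 ≤ m) (K : Fin m → Type*) [∀ i, Field (K i)] (f : ∀ i, F →+* K i)
    -- condition (I)
    (hIa : ∀ z : F, z ≠ 0 →
      (((∃ w : K₁, f₁ z = w ^ 2) ∧ ∀ i, ∃ w : K i, f i z = w ^ 2) ↔ ∃ c : F, z = c ^ 2))
    (hIb₁ : ∀ y : K₁, y ≠ 0 → ∃ (c : F) (w : K₁), c ≠ 0 ∧ y = f₁ c * w ^ 2)
    (hIb : ∀ i, ∀ y : K i, y ≠ 0 → ∃ (c : F) (w : K i), c ≠ 0 ∧ y = f i c * w ^ 2)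
    -- condition (II)
    (hII : ∀ x : F, x ≠ 0 → ∀ z : F, z ≠ 0 →
      (z ∈ DSet F x ↔ (f₁ z ∈ DSet K₁ (f₁ x) ∧ ∀ i, f i z ∈ DSet (K i) (f i x))))
    -- R(F₁) = F₁× and R(Fᵢ) = (Fᵢ×)² for the remaining factors
    (hfull : KRad K₁ = {y : K₁ | y ≠ 0})
    (htriv : ∀ i, KRad (K i) = {y : K i | y ≠ 0 ∧ ∃ w : K i, y = w ^ 2}) :
    -- (F₁×)² ∩ R(F) = F×²
    (∀ a ∈ KRad F, ((∃ w : K₁, f₁ a = w ^ 2) ↔ ∃ c : F, a = c ^ 2)) ∧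
    -- injectivity of R(F)/F×² → F₁×/(F₁×)²
    (∀ a ∈ KRad F, ∀ b ∈ KRad F,
      (∃ w : K₁, f₁ a = f₁ b * w ^ 2) → ∃ c : F, a = b * c ^ 2) := by
  have square_in_factor : ∀ a ∈ KRad F, ∀ i, ∃ w : K i, f i a = w ^ 2 := fun a ha i => by
    have h := KRad.map_mem (f i) (hIb i) ha
    rw [htriv i] at h
    exact h.2
  refine ⟨fun a ha => ⟨fun h => (hIa a ha.1).1 ⟨h, square_in_factor a ha⟩, ?_⟩, ?_⟩
  · rintro ⟨c, rfl⟩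
    exact ⟨f₁ c, map_pow f₁ c 2⟩
  · rintro a ha b hb ⟨w, hw⟩
    have hb₁ : f₁ b ≠ 0 := (map_ne_zero f₁).2 hb.1
    obtain ⟨c, hc⟩ := (hIa (a / b) (div_ne_zero ha.1 hb.1)).1 ⟨⟨w, by
      rw [map_div₀, hw, mul_div_cancel_left₀ _ hb₁]⟩, fun i => by
        obtain ⟨s, hs⟩ := square_in_factor a ha i
        obtain ⟨t, ht⟩ := square_in_factor b hb i
        exact ⟨s / t, by rw [map_div₀, hs, ht, div_pow]⟩⟩
    exact ⟨c, by rw [← hc, mul_div_cancel₀ _ hb.1]⟩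
end

section
/- Let (F, v) be a 2-henselian valued field, i.e., 1+m_v ⊆ F×², with residue field k_v of characteristic ≠ 2, whose value group satisfies Γ_v ≠ 2Γ_v, and with R(F) ≠ F×. Then F has trivial Kaplansky radical: R(F) = F×². -/
/-- Under the `2`-henselian condition, a perturbation of smaller value does not change the
square class. -/
lemma exists_add_eq_mul_sq_of_lt {F Γ₀ : Type*} [Field F] [LinearOrderedCommGroupWithZero Γ₀]
    (v : Valuation F Γ₀) (hhens : ∀ t : F, v t < 1 → ∃ c : F, 1 + t = c ^ 2)
    {s t : F} (h : v t < v s) : ∃ c : F, s + t = s * c ^ 2 := by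
  have hs : s ≠ 0 := by
    rintro rfl
    simp at h
  have hvs : 0 < v s := zero_lt_iff.2 (v.ne_zero_iff.2 hs)
  obtain ⟨c, hc⟩ := hhens (t / s) (by rw [map_div₀]; exact (div_lt_one₀ hvs).2 h)
  exact ⟨c, by rw [← hc]; field_simp⟩

lemma sq_mem_KRad {F : Type*} [Field F] (h2 : (2 : F) ≠ 0) {c : F} (hc : c ≠ 0) :
    c ^ 2 ∈ KRad F :=
  ⟨pow_ne_zero 2 hc, fun b _ => ⟨(b + 1) / 2, (b - 1) / (2 * c), by field_simp; ring⟩⟩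

lemma mul_sq_mem_KRad {F : Type*} [Field F] {a c : F} (ha : a ∈ KRad F) (hc : c ≠ 0) :
    a * c ^ 2 ∈ KRad F := by
  refine ⟨mul_ne_zero ha.1 (pow_ne_zero 2 hc), fun b hb => ?_⟩
  obtain ⟨x, y, rfl⟩ := ha.2 b hb
  exact ⟨x, y / c, by field_simp⟩

/-- If the value of `a` is not a square, then `⟨1, -a⟩` represents only the square classes of
`1` and `-a`. -/
lemma eq_sq_or_eq_neg_mul_sq {F Γ₀ : Type*} [Field F] [LinearOrderedCommGroupWithZero Γ₀]
    (v : Valuation F Γ₀) (hhens : ∀ t : F, v t < 1 → ∃ c : F, 1 + t = c ^ 2)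
    {a : F} (ha : ¬∃ ρ : Γ₀, v a = ρ ^ 2) (x y : F) :
    ∃ c : F, x ^ 2 - a * y ^ 2 = c ^ 2 ∨ x ^ 2 - a * y ^ 2 = -a * c ^ 2 := by
  rcases lt_trichotomy (v (-a * y ^ 2)) (v (x ^ 2)) with h | h | h
  · obtain ⟨c, hc⟩ := exists_add_eq_mul_sq_of_lt v hhens h
    exact ⟨x * c, Or.inl (by linear_combination hc)⟩
  · by_cases hy : y = 0
    · exact ⟨x, Or.inl (by simp [hy])⟩
    · have hvy : v y ≠ 0 := v.ne_zero_iff.2 hy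
      refine (ha ⟨v x / v y, ?_⟩).elim
      simp only [map_mul, map_pow, Valuation.map_neg] at h
      rw [div_pow, ← h, mul_div_cancel_right₀ _ (pow_ne_zero 2 hvy)]
  · obtain ⟨c, hc⟩ := exists_add_eq_mul_sq_of_lt v hhens h
    exact ⟨y * c, Or.inr (by linear_combination hc)⟩

/-- If the value of `a` is a square and `⟨1, -a⟩` represents an element whose value is not a
square, then `a` is a square. -/
lemma exists_eq_sq_of_sub_eq {F Γ₀ : Type*} [Field F] [LinearOrderedCommGroupWithZero Γ₀]
    (v : Valuation F Γ₀) (hhens : ∀ t : F, v t < 1 → ∃ c : F, 1 + t = c ^ 2)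
    {a b x y : F} (ha : ∃ ρ : Γ₀, v a = ρ ^ 2) (hb : ¬∃ ρ : Γ₀, v b = ρ ^ 2)
    (h : b = x ^ 2 - a * y ^ 2) : ∃ c : F, a = c ^ 2 := by
  have hy : y ≠ 0 := by
    rintro rfl
    exact hb ⟨v x, by simp [h]⟩
  have hay : a * y ^ 2 = x ^ 2 + -b := by rw [h]; ring
  rcases lt_trichotomy (v (-b)) (v (x ^ 2)) with hlt | heq | hgt
  · obtain ⟨c, hc⟩ := exists_add_eq_mul_sq_of_lt v hhens hlt
    refine ⟨x * c / y, ?_⟩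
    rw [div_pow, eq_div_iff (pow_ne_zero 2 hy), hay, hc, mul_pow]
  · exact (hb ⟨v x, by rw [← Valuation.map_neg, heq, map_pow]⟩).elim
  · obtain ⟨ρ, hρ⟩ := ha
    refine (hb ⟨ρ * v y, ?_⟩).elim
    rw [← Valuation.map_neg, ← v.map_add_eq_of_lt_right hgt, ← hay, map_mul, map_pow, hρ, mul_pow]

/-- Let `(F, v)` be a `2`-henselian valued field, i.e.
`1 + m_v ⊆ F×²` (where `m_v = {t | v t < 1}` is the maximal ideal of the valuation ring
of the surjective valuation `v : F → Γ₀`), with residue characteristic `≠ 2`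
(`v 2 = 1`), whose value group satisfies `Γ_v ≠ 2Γ_v` (there is a nonzero non-square
value), and with `R(F) ≠ F×`.  Then `F` has trivial Kaplansky radical: `R(F) = F×²`. -/
theorem trivial_radical_of_two_henselian
    {F Γ₀ : Type*} [Field F] [LinearOrderedCommGroupWithZero Γ₀]
    (v : Valuation F Γ₀) (hvsurj : Function.Surjective v)
    (hchar : ringChar F ≠ 2) (hres2 : v 2 = 1)
    (hhens : ∀ t : F, v t < 1 → ∃ c : F, 1 + t = c ^ 2)
    (hΓ : ∃ γ : Γ₀, γ ≠ 0 ∧ ¬∃ ρ : Γ₀, γ = ρ ^ 2)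
    (hRne : KRad F ≠ {b : F | b ≠ 0}) :
    KRad F = {z : F | z ≠ 0 ∧ ∃ c : F, z = c ^ 2} := by
  have h2 : (2 : F) ≠ 0 := by
    rintro h
    simp [h] at hres2
  refine Set.Subset.antisymm (fun a ha => ⟨ha.1, ?_⟩) ?_
  · by_cases hva : ∃ ρ : Γ₀, v a = ρ ^ 2
    · obtain ⟨γ, hγ0, hγ⟩ := hΓ
      obtain ⟨b, rfl⟩ := hvsurj γ
      obtain ⟨x, y, hxy⟩ := ha.2 b (v.ne_zero_iff.1 hγ0)
      exact exists_eq_sq_of_sub_eq v hhens hva hγ hxy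
    · have hrep (b : F) (hb : b ≠ 0) : ∃ c : F, b = c ^ 2 ∨ b = -a * c ^ 2 := by
        obtain ⟨x, y, rfl⟩ := ha.2 b hb
        exact eq_sq_or_eq_neg_mul_sq v hhens hva x y
      obtain ⟨i, hi⟩ : ∃ i : F, -1 = i ^ 2 := by
        obtain ⟨i, hi | hi⟩ := hrep (-1) (neg_ne_zero.2 one_ne_zero)
        · exact ⟨i, hi⟩
        · have hi' : a * i ^ 2 = 1 := by linear_combination hi
          refine (hva ⟨(v i)⁻¹, ?_⟩).elim
          rw [inv_pow, ← map_pow]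
          exact eq_inv_of_mul_eq_one_left (by rw [← map_mul, hi', map_one])
      refine (hRne (Set.Subset.antisymm (fun b hb => hb.1) fun b (hb : b ≠ 0) => ?_)).elim
      obtain ⟨c, rfl | hc⟩ := hrep b hb
      · exact sq_mem_KRad h2 fun hc => hb (by simp [hc])
      · have hb' : b = a * (i * c) ^ 2 := by linear_combination hc + a * c ^ 2 * hi
        rw [hb']
        exact mul_sq_mem_KRad ha fun h0 => hb (by simp [hb', h0])
  · rintro _ ⟨hz, c, rfl⟩
    exact sq_mem_KRad h2 fun hc => hz (by simp [hc])
end
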